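/- Let ν ∈ ℝ. There exist two solutions u₁ and u₂ of the modified Bessel equation u''(r) + u'(r)/r − (1 + ν²/r²)·u(r) = 0 on (0,∞) such that, as r → ∞, √r·e^{-r}·u₁(r) → 1 and √r·e^{r}·u₂(r) → 1. -/

import Mathlib

open Set Filter MeasureTheory
open scoped Topology

/-- A first-order system form of the modified Bessel equation gives a `C²` solution. -/
lemma contDiffOn_two_and_modified_bessel_of_hasDerivAt {ν : ℝ} {u u' : ℝ → ℝ}
    (hu : ∀ r, 0 < r → HasDerivAt u (u' r) r)
    (hu' : ∀ r, 0 < r → HasDerivAt u' ((1 + ν ^ 2 / r ^ 2) * u r - u' r / r) r) :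
    ContDiffOn ℝ 2 u (Ioi 0) ∧ ∀ r ∈ Ioi (0 : ℝ),
      deriv (deriv u) r + deriv u r / r - (1 + ν ^ 2 / r ^ 2) * u r = 0 := by
  have hd : EqOn (deriv u) u' (Ioi 0) := fun r hr => (hu r hr).deriv
  have hd' : EqOn (deriv u') (fun r => (1 + ν ^ 2 / r ^ 2) * u r - u' r / r) (Ioi 0) :=
    fun r hr => (hu' r hr).deriv
  have hcu : ContinuousOn u (Ioi 0) := fun r hr => (hu r hr).continuousAt.continuousWithinAt
  have hcu' : ContinuousOn u' (Ioi 0) := fun r hr => (hu' r hr).continuousAt.continuousWithinAt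
  refine ⟨?_, fun r hr => ?_⟩
  · rw [show (2 : WithTop ℕ∞) = 1 + 1 by norm_num, contDiffOn_succ_iff_deriv_of_isOpen isOpen_Ioi]
    refine ⟨fun r hr => (hu r hr).differentiableAt.differentiableWithinAt, by simp, ?_⟩
    refine ContDiffOn.congr ?_ hd
    rw [show (1 : WithTop ℕ∞) = 0 + 1 by norm_num, contDiffOn_succ_iff_deriv_of_isOpen isOpen_Ioi]
    refine ⟨fun r hr => (hu' r hr).differentiableAt.differentiableWithinAt, by simp, ?_⟩
    rw [contDiffOn_zero]
    refine ContinuousOn.congr ?_ hd'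
    have h0 : ∀ r ∈ Ioi (0 : ℝ), r ≠ 0 := fun r hr => (mem_Ioi.1 hr).ne'
    have h2 : ∀ r ∈ Ioi (0 : ℝ), r ^ 2 ≠ 0 := fun r hr => pow_ne_zero 2 (h0 r hr)
    exact ((continuousOn_const.add
      (continuousOn_const.div (continuousOn_id.pow 2) h2)).mul hcu).sub
        (hcu'.div continuousOn_id h0)
  · have h : deriv u =ᶠ[𝓝 r] u' := hd.eventuallyEq_of_mem (Ioi_mem_nhds hr)
    rw [h.deriv_eq, hd hr, hd' hr]
    ring

lemma one_add_sq_div_two_le_cosh (t : ℝ) : 1 + t ^ 2 / 2 ≤ Real.cosh t := by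
  have h1 : Real.cosh t = 1 + 2 * Real.sinh (t / 2) ^ 2 := by
    have := Real.cosh_two_mul (t / 2)
    rw [mul_div_cancel₀ _ two_ne_zero, Real.cosh_sq] at this
    linarith
  have h2 : (t / 2) ^ 2 ≤ Real.sinh (t / 2) ^ 2 := by
    rw [sq_le_sq, Real.abs_sinh]
    exact Real.self_le_sinh_iff.2 (abs_nonneg _)
  rw [h1]
  linarith

/-- Twice the Macdonald function `K_μ`, as an integral over the whole line. -/
noncomputable def macdonaldIntegral (μ r : ℝ) : ℝ :=
  ∫ t : ℝ, Real.exp (-r * Real.cosh t + μ * t)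

lemma integrable_macdonaldIntegral (μ : ℝ) {r : ℝ} (hr : 0 < r) :
    Integrable fun t : ℝ => Real.exp (-r * Real.cosh t + μ * t) := by
  refine ((integrable_exp_neg_mul_sq (show 0 < r / 4 by positivity)).const_mul
    (Real.exp (μ ^ 2 / r))).mono' (by fun_prop) (ae_of_all _ fun t => ?_)
  rw [Real.norm_eq_abs, Real.abs_exp, ← Real.exp_add, Real.exp_le_exp]
  have h1 := mul_le_mul_of_nonneg_left (one_add_sq_div_two_le_cosh t) hr.le
  have h2 : μ ^ 2 / r + r / 4 * t ^ 2 - μ * t = (μ - r / 2 * t) ^ 2 / r := by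
    field_simp
    ring
  have h3 : 0 ≤ (μ - r / 2 * t) ^ 2 / r := by positivity
  linarith

lemma macdonaldIntegral_pos (μ : ℝ) {r : ℝ} (hr : 0 < r) : 0 < macdonaldIntegral μ r :=
  integral_exp_pos (integrable_macdonaldIntegral μ hr)

lemma cosh_mul_exp_macdonald (μ r t : ℝ) :
    Real.cosh t * Real.exp (-r * Real.cosh t + μ * t) =
      (Real.exp (-r * Real.cosh t + (μ + 1) * t) +
        Real.exp (-r * Real.cosh t + (μ - 1) * t)) / 2 := by
  rw [show -r * Real.cosh t + (μ + 1) * t = (-r * Real.cosh t + μ * t) + t by ring,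
    show -r * Real.cosh t + (μ - 1) * t = (-r * Real.cosh t + μ * t) + -t by ring,
    Real.exp_add _ t, Real.exp_add _ (-t), Real.cosh_eq t]
  ring

lemma sinh_mul_exp_macdonald (μ r t : ℝ) :
    Real.sinh t * Real.exp (-r * Real.cosh t + μ * t) =
      (Real.exp (-r * Real.cosh t + (μ + 1) * t) -
        Real.exp (-r * Real.cosh t + (μ - 1) * t)) / 2 := by
  rw [show -r * Real.cosh t + (μ + 1) * t = (-r * Real.cosh t + μ * t) + t by ring,
    show -r * Real.cosh t + (μ - 1) * t = (-r * Real.cosh t + μ * t) + -t by ring,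
    Real.exp_add _ t, Real.exp_add _ (-t), Real.sinh_eq t]
  ring

lemma hasDerivAt_macdonaldIntegral (μ : ℝ) {r : ℝ} (hr : 0 < r) :
    HasDerivAt (macdonaldIntegral μ)
      (-(macdonaldIntegral (μ + 1) r + macdonaldIntegral (μ - 1) r) / 2) r := by
  have hcosh (s : ℝ) (hs : 0 < s) :
      Integrable fun t : ℝ => Real.cosh t * Real.exp (-s * Real.cosh t + μ * t) := by
    simp_rw [cosh_mul_exp_macdonald]
    exact ((integrable_macdonaldIntegral _ hs).add (integrable_macdonaldIntegral _ hs)).div_const 2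
  have key := (hasDerivAt_integral_of_dominated_loc_of_deriv_le (μ := volume)
    (F := fun s t : ℝ => Real.exp (-s * Real.cosh t + μ * t))
    (F' := fun s t : ℝ => -(Real.cosh t * Real.exp (-s * Real.cosh t + μ * t)))
    (bound := fun t : ℝ => Real.cosh t * Real.exp (-(r / 2) * Real.cosh t + μ * t))
    (Ioi_mem_nhds (half_lt_self hr)) (Eventually.of_forall fun s => by fun_prop)
    (integrable_macdonaldIntegral μ hr) (by fun_prop) (ae_of_all _ fun t s hs => ?_)
    (hcosh _ (half_pos hr)) (ae_of_all _ fun t s _ => ?_)).2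
  · refine key.congr_deriv ?_
    simp_rw [cosh_mul_exp_macdonald]
    rw [integral_neg, integral_div, integral_add (integrable_macdonaldIntegral _ hr)
      (integrable_macdonaldIntegral _ hr)]
    simp only [macdonaldIntegral]
    ring
  · rw [norm_neg, Real.norm_eq_abs, abs_of_nonneg (by positivity)]
    have := (mem_Ioi.1 hs).le
    gcongr
  · have h : HasDerivAt (fun s : ℝ => -s * Real.cosh t + μ * t) (-Real.cosh t) s := by
      simpa using ((hasDerivAt_id s).neg.mul_const (Real.cosh t)).add_const (μ * t)
    exact h.exp.congr_deriv (by ring)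

lemma mul_macdonaldIntegral_eq (μ : ℝ) {r : ℝ} (hr : 0 < r) :
    μ * macdonaldIntegral μ r =
      r / 2 * (macdonaldIntegral (μ + 1) r - macdonaldIntegral (μ - 1) r) := by
  have hi := integrable_macdonaldIntegral μ hr
  have hp := integrable_macdonaldIntegral (μ + 1) hr
  have hm := integrable_macdonaldIntegral (μ - 1) hr
  have hder (t : ℝ) : HasDerivAt (fun t : ℝ => Real.exp (-r * Real.cosh t + μ * t))
      (μ * Real.exp (-r * Real.cosh t + μ * t) -
        r / 2 * (Real.exp (-r * Real.cosh t + (μ + 1) * t) -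
          Real.exp (-r * Real.cosh t + (μ - 1) * t))) t := by
    have h : HasDerivAt (fun t : ℝ => -r * Real.cosh t + μ * t) (-r * Real.sinh t + μ) t := by
      exact (((Real.hasDerivAt_cosh t).const_mul (-r)).add
        ((hasDerivAt_id t).const_mul μ)).congr_deriv (by ring)
    refine h.exp.congr_deriv ?_
    linear_combination -r * sinh_mul_exp_macdonald μ r t
  have h0 := integral_eq_zero_of_hasDerivAt_of_integrable hder
    ((hi.const_mul _).sub ((hp.sub hm).const_mul _)) hi
  rw [integral_sub (hi.const_mul μ) (by exact (hp.sub hm).const_mul (r / 2)), integral_const_mul,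
    integral_const_mul, integral_sub hp hm] at h0
  exact sub_eq_zero.1 h0

lemma hasDerivAt_deriv_macdonaldIntegral (ν : ℝ) {r : ℝ} (hr : 0 < r) :
    HasDerivAt (fun r => -(macdonaldIntegral (ν + 1) r + macdonaldIntegral (ν - 1) r) / 2)
      ((1 + ν ^ 2 / r ^ 2) * macdonaldIntegral ν r -
        -(macdonaldIntegral (ν + 1) r + macdonaldIntegral (ν - 1) r) / 2 / r) r := by
  have h := ((hasDerivAt_macdonaldIntegral (ν + 1) hr).add
    (hasDerivAt_macdonaldIntegral (ν - 1) hr)).neg.div_const 2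
  refine h.congr_deriv ?_
  have h0 := mul_macdonaldIntegral_eq ν hr
  have h1 := mul_macdonaldIntegral_eq (ν + 1) hr
  have h2 := mul_macdonaldIntegral_eq (ν - 1) hr
  rw [add_sub_cancel_right] at h1 ⊢
  rw [sub_add_cancel] at h2 ⊢
  field_simp
  linear_combination -4 * ν * h0 - 2 * r * h1 + 2 * r * h2

lemma tendsto_sqrt_mul_exp_mul_macdonaldIntegral (ν : ℝ) :
    Tendsto (fun r => Real.sqrt r * Real.exp r * macdonaldIntegral ν r) atTop
      (𝓝 (Real.sqrt (2 * Real.pi))) := by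
  have hlim := tendsto_integral_filter_of_dominated_convergence (μ := volume) (l := atTop)
    (F := fun r s : ℝ => Real.exp
      (-(r * (Real.cosh (s / Real.sqrt r) - 1)) + ν * (s / Real.sqrt r)))
    (f := fun s : ℝ => Real.exp (-(1 / 2) * s ^ 2))
    (fun s => Real.exp (ν ^ 2) * Real.exp (-(1 / 4) * s ^ 2))
    (Eventually.of_forall fun r => by fun_prop) ?_
    ((integrable_exp_neg_mul_sq (by norm_num)).const_mul _) (ae_of_all _ fun s => ?_)
  · rw [integral_gaussian, show Real.pi / (1 / 2) = 2 * Real.pi by ring] at hlim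
    refine hlim.congr' ?_
    filter_upwards [eventually_gt_atTop 0] with r hr
    have hs : 0 < Real.sqrt r := Real.sqrt_pos.2 hr
    rw [integral_congr_ae (ae_of_all _ fun s => show _ = (fun t => Real.exp r *
      Real.exp (-r * Real.cosh t + ν * t)) (s / Real.sqrt r) by
        simp only [← Real.exp_add]; ring_nf), Measure.integral_comp_div (fun t => Real.exp r *
        Real.exp (-r * Real.cosh t + ν * t)), integral_const_mul,
      abs_of_pos hs, smul_eq_mul, macdonaldIntegral, mul_assoc]
  · filter_upwards [eventually_ge_atTop 1] with r hr
    refine ae_of_all _ fun s => ?_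
    have hs : 1 ≤ Real.sqrt r := Real.one_le_sqrt.2 hr
    rw [Real.norm_eq_abs, Real.abs_exp, ← Real.exp_add, Real.exp_le_exp]
    have h1 := mul_le_mul_of_nonneg_left (one_add_sq_div_two_le_cosh (s / Real.sqrt r))
      (zero_le_one.trans hr)
    have h2 : r * (s / Real.sqrt r) ^ 2 = s ^ 2 := by
      rw [div_pow, Real.sq_sqrt (by linarith)]
      field_simp
    have h3 : (s / Real.sqrt r) ^ 2 ≤ s ^ 2 := by nlinarith [sq_nonneg (s / Real.sqrt r)]
    nlinarith [sq_nonneg (ν - s / Real.sqrt r / 2)]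
  · have hinv : Tendsto (fun r : ℝ => (Real.sqrt r)⁻¹) atTop (𝓝 0) :=
      tendsto_inv_atTop_zero.comp Real.tendsto_sqrt_atTop
    have hdiv : Tendsto (fun r : ℝ => s / Real.sqrt r) atTop (𝓝 0) := by
      simpa [div_eq_mul_inv] using hinv.const_mul s
    have hsinh : Tendsto (fun r : ℝ => Real.sqrt r * Real.sinh (s / 2 * (Real.sqrt r)⁻¹)) atTop
        (𝓝 (s / 2)) := by
      have hd : HasDerivAt (fun x : ℝ => Real.sinh (s / 2 * x)) (s / 2) 0 := by
        simpa using ((hasDerivAt_id (0 : ℝ)).const_mul (s / 2)).sinh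
      have hne : Tendsto (fun r : ℝ => (Real.sqrt r)⁻¹) atTop (𝓝[≠] 0) :=
        tendsto_nhdsWithin_iff.2 ⟨hinv, by
          filter_upwards [eventually_gt_atTop 0] with r hr
          exact inv_ne_zero (Real.sqrt_pos.2 hr).ne'⟩
      simpa [Function.comp_def] using hd.tendsto_slope_zero.comp hne
    refine (Real.continuous_exp.tendsto _).comp ?_
    have h := ((hsinh.pow 2).const_mul (-2)).add (hdiv.const_mul ν)
    rw [show -2 * (s / 2) ^ 2 + ν * 0 = -(1 / 2) * s ^ 2 by ring] at h
    refine h.congr' ?_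
    filter_upwards [eventually_gt_atTop 0] with r hr
    have hc : Real.cosh (s / Real.sqrt r) = 1 + 2 * Real.sinh (s / 2 * (Real.sqrt r)⁻¹) ^ 2 := by
      have := Real.cosh_two_mul (s / 2 * (Real.sqrt r)⁻¹)
      rw [show 2 * (s / 2 * (Real.sqrt r)⁻¹) = s / Real.sqrt r by ring, Real.cosh_sq] at this
      linarith
    rw [hc, mul_pow, Real.sq_sqrt hr.le]
    ring

lemma eventually_exp_neg_two_mul_lt {F f : ℝ → ℝ} {c c' : ℝ} (hc : c < c')
    (hF : ∀ r, 0 < r → HasDerivAt F (f r) r)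
    (hf : ∀ᶠ r in atTop, Real.exp (-2 * r) * f r < c) :
    ∀ᶠ r in atTop, Real.exp (-2 * r) * F r < c' / 2 := by
  obtain ⟨R, hR⟩ := eventually_atTop.1 (hf.and (eventually_gt_atTop 0))
  have hR0 : 0 < R := (hR R le_rfl).2
  have hder (r : ℝ) (hr : 0 < r) :
      HasDerivAt (fun r => F r - c / 2 * Real.exp (2 * r)) (f r - c * Real.exp (2 * r)) r := by
    have h : HasDerivAt (fun r : ℝ => Real.exp (2 * r)) (Real.exp (2 * r) * 2) r := by
      simpa using ((hasDerivAt_id r).const_mul 2).exp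
    exact ((hF r hr).sub (h.const_mul (c / 2))).congr_deriv (by ring)
  have hanti : AntitoneOn (fun r => F r - c / 2 * Real.exp (2 * r)) (Ici R) := by
    refine antitoneOn_of_deriv_nonpos (convex_Ici R)
      (fun r hr => (hder r (hR0.trans_le hr)).continuousAt.continuousWithinAt)
      (fun r hr => ?_) (fun r hr => ?_)
    · rw [interior_Ici] at hr
      exact (hder r (hR0.trans hr)).differentiableAt.differentiableWithinAt
    · rw [interior_Ici] at hr
      rw [(hder r (hR0.trans hr)).deriv]
      have h := (mul_lt_mul_of_pos_left (hR r (le_of_lt hr)).1 (Real.exp_pos (2 * r))).le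
      rw [← mul_assoc, ← Real.exp_add] at h
      simp only [neg_mul, add_neg_cancel, Real.exp_zero, one_mul] at h
      linarith
  set C := F R - c / 2 * Real.exp (2 * R)
  have hexp : Tendsto (fun r : ℝ => C * Real.exp (-2 * r)) atTop (𝓝 0) := by
    have : Tendsto (fun r : ℝ => Real.exp (-2 * r)) atTop (𝓝 0) :=
      Real.tendsto_exp_atBot.comp (tendsto_id.const_mul_atTop_of_neg (by norm_num))
    simpa using this.const_mul C
  filter_upwards [hexp.eventually (gt_mem_nhds (show 0 < (c' - c) / 2 by linarith)),
    eventually_ge_atTop R] with r h1 h2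
  have h3 : F r - c / 2 * Real.exp (2 * r) ≤ C := hanti self_mem_Ici h2 h2
  have h4 := mul_le_mul_of_nonneg_left h3 (Real.exp_pos (-2 * r)).le
  have h5 : Real.exp (-2 * r) * Real.exp (2 * r) = 1 := by
    rw [← Real.exp_add]
    simp
  have h6 : Real.exp (-2 * r) * (F r - c / 2 * Real.exp (2 * r)) =
      Real.exp (-2 * r) * F r - c / 2 := by
    linear_combination -(c / 2) * h5
  linarith

/-- An instance of L'Hôpital's rule of type `∞ / ∞`. -/
lemma tendsto_exp_neg_two_mul {F f : ℝ → ℝ} {L : ℝ}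
    (hF : ∀ r, 0 < r → HasDerivAt F (f r) r)
    (hf : Tendsto (fun r => Real.exp (-2 * r) * f r) atTop (𝓝 L)) :
    Tendsto (fun r => Real.exp (-2 * r) * F r) atTop (𝓝 (L / 2)) := by
  refine tendsto_order.2 ⟨fun a ha => ?_, fun a ha => ?_⟩
  · have h := eventually_exp_neg_two_mul_lt (c := -(L / 2 + a)) (c' := -(2 * a)) (by linarith)
      (fun r hr => (hF r hr).neg) (by
        filter_upwards [hf.eventually (lt_mem_nhds (show L / 2 + a < L by linarith))] with r hr
        linarith)
    filter_upwards [h] with r hr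
    simp only [Pi.neg_apply] at hr
    linarith
  · have h := eventually_exp_neg_two_mul_lt (c := L / 2 + a) (c' := 2 * a) (by linarith) hF
      (hf.eventually (gt_mem_nhds (by linarith)))
    filter_upwards [h] with r hr
    linarith

/-- Reduction of order: a positive solution `v ∼ e^{-r} / √r` of the modified Bessel equation
yields a solution `u ∼ e^r / √r`. -/
lemma exists_growing_solution_of_decaying_solution {ν : ℝ} {v v' : ℝ → ℝ}
    (hpos : ∀ r, 0 < r → 0 < v r)
    (hv : ∀ r, 0 < r → HasDerivAt v (v' r) r)
    (hv' : ∀ r, 0 < r → HasDerivAt v' ((1 + ν ^ 2 / r ^ 2) * v r - v' r / r) r)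
    (hlim : Tendsto (fun r => Real.sqrt r * Real.exp r * v r) atTop (𝓝 1)) :
    ∃ u u' : ℝ → ℝ, (∀ r, 0 < r → HasDerivAt u (u' r) r) ∧
      (∀ r, 0 < r → HasDerivAt u' ((1 + ν ^ 2 / r ^ 2) * u r - u' r / r) r) ∧
      Tendsto (fun r => Real.sqrt r * Real.exp (-r) * u r) atTop (𝓝 1) := by
  have hcont : ContinuousOn (fun s => (s * v s ^ 2)⁻¹) (Ioi 0) := fun s hs =>
    ((continuousAt_id.mul ((hv s hs).continuousAt.pow 2)).inv₀
      (mul_pos hs (pow_pos (hpos s hs) 2)).ne').continuousWithinAt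
  have hJ (r : ℝ) (hr : 0 < r) :
      HasDerivAt (fun r => ∫ s in (1 : ℝ)..r, (s * v s ^ 2)⁻¹) ((r * v r ^ 2)⁻¹) r := by
    refine intervalIntegral.integral_hasDerivAt_right ?_ ?_
      (hcont.continuousAt (Ioi_mem_nhds hr))
    · refine (hcont.mono fun s hs => ?_).intervalIntegrable
      exact (lt_min one_pos hr).trans_le hs.1
    · exact hcont.stronglyMeasurableAtFilter isOpen_Ioi r hr
  set J : ℝ → ℝ := fun r => ∫ s in (1 : ℝ)..r, (s * v s ^ 2)⁻¹
  refine ⟨fun r => 2 * (v r * J r), fun r => 2 * (v' r * J r + (r * v r)⁻¹), fun r hr => ?_,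
    fun r hr => ?_, ?_⟩
  · refine (((hv r hr).mul (hJ r hr)).const_mul 2).congr_deriv ?_
    have := hpos r hr
    field_simp
  · have h0 := hpos r hr
    have hi := ((hasDerivAt_id r).mul (hv r hr)).inv (mul_pos hr h0).ne'
    refine ((((hv' r hr).mul (hJ r hr)).add hi).const_mul 2).congr_deriv ?_
    simp only [Pi.mul_apply, id]
    field_simp
    ring
  · have h1 : Tendsto (fun r => Real.exp (-2 * r) * (r * v r ^ 2)⁻¹) atTop (𝓝 1) := by
      have h := (hlim.pow 2).inv₀ (by norm_num)
      rw [one_pow, inv_one] at h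
      refine h.congr' ?_
      filter_upwards [eventually_gt_atTop 0] with r hr
      rw [mul_pow, mul_pow, Real.sq_sqrt hr.le, ← Real.exp_nat_mul,
        show -2 * r = -((2 : ℕ) * r) by push_cast; ring, Real.exp_neg, ← mul_inv]
      ring
    have h2 := (hlim.mul (tendsto_exp_neg_two_mul hJ h1)).const_mul 2
    norm_num at h2
    refine h2.congr fun r => ?_
    rw [show -r = r + -(2 * r) by ring, Real.exp_add]
    ring

/-- There exist two solutions `u₁, u₂` of the modified Bessel equation
`u'' + u'/r - (1 + ν²/r²) u = 0` on `(0,∞)` with `√r e^{-r} u₁(r) → 1` and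
`√r e^{r} u₂(r) → 1` as `r → ∞`. -/
theorem modified_bessel_asymptotics
    (ν : ℝ) :
    ∃ u₁ u₂ : ℝ → ℝ,
      ContDiffOn ℝ 2 u₁ (Ioi 0) ∧
      (∀ r ∈ Ioi (0 : ℝ),
        deriv (deriv u₁) r + deriv u₁ r / r - (1 + ν ^ 2 / r ^ 2) * u₁ r = 0) ∧
      ContDiffOn ℝ 2 u₂ (Ioi 0) ∧
      (∀ r ∈ Ioi (0 : ℝ),
        deriv (deriv u₂) r + deriv u₂ r / r - (1 + ν ^ 2 / r ^ 2) * u₂ r = 0) ∧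
      Tendsto (fun r => Real.sqrt r * Real.exp (-r) * u₁ r) atTop (𝓝 1) ∧
      Tendsto (fun r => Real.sqrt r * Real.exp r * u₂ r) atTop (𝓝 1) := by
  set k := Real.sqrt (2 * Real.pi)
  have hk : 0 < k := Real.sqrt_pos.2 Real.two_pi_pos
  let v : ℝ → ℝ := fun r => macdonaldIntegral ν r / k
  let v' : ℝ → ℝ := fun r => -(macdonaldIntegral (ν + 1) r + macdonaldIntegral (ν - 1) r) / 2 / k
  have hv (r : ℝ) (hr : 0 < r) : HasDerivAt v (v' r) r :=
    (hasDerivAt_macdonaldIntegral ν hr).div_const k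
  have hv' (r : ℝ) (hr : 0 < r) :
      HasDerivAt v' ((1 + ν ^ 2 / r ^ 2) * v r - v' r / r) r := by
    refine ((hasDerivAt_deriv_macdonaldIntegral ν hr).div_const k).congr_deriv ?_
    simp only [v, v']
    ring
  have hlim : Tendsto (fun r => Real.sqrt r * Real.exp r * v r) atTop (𝓝 1) := by
    have h := (tendsto_sqrt_mul_exp_mul_macdonaldIntegral ν).div_const k
    rw [div_self hk.ne'] at h
    exact h.congr fun r => mul_div_assoc _ _ _
  obtain ⟨u, u', hu, hu', hlim'⟩ := exists_growing_solution_of_decaying_solution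
    (fun r hr => div_pos (macdonaldIntegral_pos ν hr) hk) hv hv' hlim
  obtain ⟨hu2, hueq⟩ := contDiffOn_two_and_modified_bessel_of_hasDerivAt hu hu'
  obtain ⟨hv2, hveq⟩ := contDiffOn_two_and_modified_bessel_of_hasDerivAt hv hv'
  exact ⟨u, v, hu2, hueq, hv2, hveq, hlim', hlim⟩
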